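/- Let s > 0, r₀ > 0, ρ₀ ∈ ℝ with ρ₀² < s², set c = r₀ sqrt(s² − ρ₀²), and let e ∈ ℝ^d with ‖e‖ = 1. Define r(t) = sqrt(s²t² + 2 r₀ ρ₀ t + r₀²) and θ(t) = arctan((s² t + r₀ ρ₀)/c) − arctan(r₀ ρ₀ / c). Given a₀ ∈ ℝ^d and b₀ ∈ ℝ, write α₀ = ⟨a₀, e⟩ and a₀^⊥ = a₀ − α₀ e, and define a(t) = (r₀ / r(t)) a₀^⊥ + ((r₀ α₀ cos θ(t) − b₀ sin θ(t)) / r(t)) e and b(t) = r₀ α₀ sin θ(t) + b₀ cos θ(t). Then for all t ∈ ℝ, r(t)²‖a(t)‖² + b(t)² = r₀²‖a₀‖² + b₀². That is, the explicit parallel transport formulas along a cone geodesic preserve the cone norm of the transported tangent vector. -/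

import Mathlib

open Real
open scoped RealInnerProductSpace

noncomputable section

/-- The squared radial coordinate of a cone geodesic is positive when `ρ₀ ^ 2 < s ^ 2`. -/
theorem cone_radius_sq_pos {s r₀ ρ₀ : ℝ} (hr₀ : r₀ ≠ 0) (hρ₀ : ρ₀ ^ 2 < s ^ 2) (t : ℝ) :
    0 < s ^ 2 * t ^ 2 + 2 * r₀ * ρ₀ * t + r₀ ^ 2 := by
  rcases eq_or_ne t 0 with rfl | ht
  · simpa using pow_pos (abs_pos.2 hr₀) 2
  · have h : 0 < (s ^ 2 - ρ₀ ^ 2) * t ^ 2 := mul_pos (sub_pos.2 hρ₀) (by positivity)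
    linarith [sq_nonneg (ρ₀ * t + r₀)]

/-- Pythagoras for a combination of a unit vector and a vector orthogonal to it. -/
theorem norm_smul_add_smul_sq_of_inner_eq_zero {E : Type*} [NormedAddCommGroup E]
    [InnerProductSpace ℝ E] {e v : E} (he : ‖e‖ = 1) (hv : ⟪v, e⟫ = 0) (x y : ℝ) :
    ‖x • v + y • e‖ ^ 2 = x ^ 2 * ‖v‖ ^ 2 + y ^ 2 := by
  rw [norm_add_sq_real, real_inner_smul_left, real_inner_smul_right, hv, norm_smul, norm_smul, he,
    mul_pow, mul_one, Real.norm_eq_abs, Real.norm_eq_abs, sq_abs, sq_abs]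
  ring

/-- The explicit parallel transport formulas along a cone geodesic preserve the cone norm
of the transported tangent vector: `r(t)²‖a(t)‖² + b(t)² = r₀²‖a₀‖² + b₀²` for all `t`. -/
theorem cone_parallel_transport_preserves_norm {d : ℕ}
    (s r₀ ρ₀ c : ℝ) (hs : 0 < s) (hr₀ : 0 < r₀) (hρ₀ : ρ₀ ^ 2 < s ^ 2)
    (hc : c = r₀ * Real.sqrt (s ^ 2 - ρ₀ ^ 2))
    (e : EuclideanSpace ℝ (Fin d)) (he : ‖e‖ = 1)
    (a₀ : EuclideanSpace ℝ (Fin d)) (b₀ : ℝ)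
    (r : ℝ → ℝ)
    (hr : ∀ t, r t = Real.sqrt (s ^ 2 * t ^ 2 + 2 * r₀ * ρ₀ * t + r₀ ^ 2))
    (θ : ℝ → ℝ)
    (hθ : ∀ t, θ t = Real.arctan ((s ^ 2 * t + r₀ * ρ₀) / c)
        - Real.arctan (r₀ * ρ₀ / c))
    (α₀ : ℝ) (hα₀ : α₀ = ⟪a₀, e⟫)
    (aperp : EuclideanSpace ℝ (Fin d)) (haperp : aperp = a₀ - α₀ • e)
    (a : ℝ → EuclideanSpace ℝ (Fin d))
    (ha : ∀ t, a t = (r₀ / r t) • aperp +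
        ((r₀ * α₀ * Real.cos (θ t) - b₀ * Real.sin (θ t)) / r t) • e)
    (b : ℝ → ℝ)
    (hb : ∀ t, b t = r₀ * α₀ * Real.sin (θ t) + b₀ * Real.cos (θ t)) :
    ∀ t : ℝ, r t ^ 2 * ‖a t‖ ^ 2 + b t ^ 2 = r₀ ^ 2 * ‖a₀‖ ^ 2 + b₀ ^ 2 := by
  intro t
  have hr_pos : 0 < r t := by
    rw [hr]
    exact Real.sqrt_pos.2 (cone_radius_sq_pos hr₀.ne' hρ₀ t)
  have h_orth : ⟪aperp, e⟫ = 0 := by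
    rw [haperp, hα₀, inner_sub_left, real_inner_smul_left, real_inner_self_eq_norm_sq, he]
    ring
  have ha₀ : a₀ = (1 : ℝ) • aperp + α₀ • e := by
    rw [haperp]
    module
  have hnorm : ‖a₀‖ ^ 2 = ‖aperp‖ ^ 2 + α₀ ^ 2 := by
    rw [ha₀, norm_smul_add_smul_sq_of_inner_eq_zero he h_orth]
    ring
  rw [ha, norm_smul_add_smul_sq_of_inner_eq_zero he h_orth, hb, hnorm]
  field_simp
  linear_combination (r₀ ^ 2 * α₀ ^ 2 + b₀ ^ 2) * Real.sin_sq_add_cos_sq (θ t)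

end
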